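/- Let t ≥ 1, let f ∈ ∑_{1≤i,j≤t} A(i) ⊗ A(j), let n > 2t be a natural number, and set H' = ∑_{0≤i,j≤t} A(i) ⊗ A(j). Then there exists a homogeneous K-subspace T' ⊆ (∑_{i : (n−t)/(2t) ≤ i ≤ 2tn+t} A(i)) ⊗ A(n) with dim_K T' < 2^{4t+3}·n³·t² such that, for every integer m ≥ n, H'·f^m ⊆ T'·H'·f^{m−n}·(A ⊗_K A). -/

import Mathlib

open TensorProduct

noncomputable section

/-- The free associative unital `K`-algebra on two generators `x, y`. -/
abbrev FA (K : Type) [Field K] : Type := FreeAlgebra K (Fin 2)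

/-- `gp K n` is `A(n)`, the span of the words of length `n` in the two generators. -/
def gp (K : Type) [Field K] (n : ℕ) : Submodule K (FA K) :=
  Submodule.span K {a : FA K | ∃ w : List (Fin 2), w.length = n ∧ a = (w.map (FreeAlgebra.ι K)).prod}

/-- The canonical image of `U ⊗[K] V` inside `A ⊗[K] A`. -/
def tp (K : Type) [Field K] (U V : Submodule K (FA K)) : Submodule K (FA K ⊗[K] FA K) :=
  Submodule.map₂ (TensorProduct.mk K (FA K) (FA K)) U V

/-- `∑_{i : (n−t)/(2t) ≤ i ≤ 2tn+t} A(i)`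
(the condition `(n−t)/(2t) ≤ i` is encoded as `n ≤ 2ti + t`). -/
def midGp' (K : Type) [Field K] (t n : ℕ) : Submodule K (FA K) :=
  ⨆ i ∈ {i : ℕ | n ≤ 2 * t * i + t ∧ i ≤ 2 * t * n + t}, gp K i

/-- `∑_{0 ≤ i, j ≤ t} A(i) ⊗ A(j)`. -/
def Hsp (K : Type) [Field K] (t : ℕ) : Submodule K (FA K ⊗[K] FA K) :=
  ⨆ i ∈ Finset.Iic t, ⨆ j ∈ Finset.Iic t, tp K (gp K i) (gp K j)

/-- A subspace of `A ⊗[K] A` is homogeneous if it is spanned by elements lying in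
subspaces of the form `A(i) ⊗ A(j)`. -/
def IsHomog (K : Type) [Field K] (S : Submodule K (FA K ⊗[K] FA K)) : Prop :=
  ∃ B : Set (FA K ⊗[K] FA K),
    (∀ x ∈ B, ∃ i j : ℕ, x ∈ tp K (gp K i) (gp K j)) ∧ S = Submodule.span K B

/-- The monomial of `FA K` given by a word. -/
def wordMonomial (K : Type) [Field K] (w : List (Fin 2)) : FA K :=
  (w.map (FreeAlgebra.ι K)).prod

lemma wordMonomial_mem_gp (K : Type) [Field K] (w : List (Fin 2)) :
    wordMonomial K w ∈ gp K w.length :=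
  Submodule.subset_span ⟨w, rfl, rfl⟩

lemma wordMonomial_append (K : Type) [Field K] (v w : List (Fin 2)) :
    wordMonomial K (v ++ w) = wordMonomial K v * wordMonomial K w := by
  simp [wordMonomial]

lemma tmul_mem_tp {K : Type} [Field K] {U V : Submodule K (FA K)} {a b : FA K}
    (ha : a ∈ U) (hb : b ∈ V) : a ⊗ₜ[K] b ∈ tp K U V :=
  Submodule.apply_mem_map₂ (TensorProduct.mk K (FA K) (FA K)) ha hb

/-- To bound `A(a) ⊗ A(b)` by a subspace it suffices to test pairs of words. -/
lemma tp_gp_le_iff {K : Type} [Field K] {a b : ℕ} {W : Submodule K (FA K ⊗[K] FA K)} :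
    tp K (gp K a) (gp K b) ≤ W ↔ ∀ v w : List (Fin 2), v.length = a → w.length = b →
      wordMonomial K v ⊗ₜ[K] wordMonomial K w ∈ W := by
  constructor
  · rintro h v w rfl rfl
    exact h (tmul_mem_tp (wordMonomial_mem_gp K v) (wordMonomial_mem_gp K w))
  · intro h
    rw [tp, gp, gp, Submodule.map₂_span_span, Submodule.span_le]
    rintro _ ⟨_, ⟨v, hv, rfl⟩, _, ⟨w, hw, rfl⟩, rfl⟩
    exact h v w hv hw

lemma mul_mem_tp_gp {K : Type} [Field K] {a b c d : ℕ} {x y : FA K ⊗[K] FA K}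
    (hx : x ∈ tp K (gp K a) (gp K b)) (hy : y ∈ tp K (gp K c) (gp K d)) :
    x * y ∈ tp K (gp K (a + c)) (gp K (b + d)) := by
  have hleft : tp K (gp K a) (gp K b) ≤
      (tp K (gp K (a + c)) (gp K (b + d))).comap (LinearMap.mulRight K y) := by
    rw [tp_gp_le_iff]
    rintro v w rfl rfl
    have hright : tp K (gp K c) (gp K d) ≤
        (tp K (gp K (v.length + c)) (gp K (w.length + d))).comap
          (LinearMap.mulLeft K (wordMonomial K v ⊗ₜ[K] wordMonomial K w)) := by
      rw [tp_gp_le_iff]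
      rintro v₁ w₁ rfl rfl
      rw [Submodule.mem_comap, LinearMap.mulLeft_apply, Algebra.TensorProduct.tmul_mul_tmul,
        ← wordMonomial_append, ← wordMonomial_append, ← List.length_append, ← List.length_append]
      exact tmul_mem_tp (wordMonomial_mem_gp K _) (wordMonomial_mem_gp K _)
    exact hright hy
  exact hleft hx

/-- An element of `A(a) ⊗ A(n + r)` is a combination of the `1 ⊗ v`, for `v` a word of length `r`,
with left coefficients in `A(a) ⊗ A(n)`. -/
lemma exists_right_coefficients {K : Type} [Field K] {a n r : ℕ} {x : FA K ⊗[K] FA K}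
    (hx : x ∈ tp K (gp K a) (gp K (n + r))) :
    ∃ u : List.Vector (Fin 2) r → FA K ⊗[K] FA K, (∀ v, u v ∈ tp K (gp K a) (gp K n)) ∧
      x = ∑ v, u v * (1 ⊗ₜ[K] wordMonomial K v.toList) := by
  let c : (List.Vector (Fin 2) r → FA K ⊗[K] FA K) →ₗ[K] FA K ⊗[K] FA K :=
    ∑ v, LinearMap.mulRight K ((1 : FA K) ⊗ₜ[K] wordMonomial K v.toList) ∘ₗ LinearMap.proj v
  have hc (u) : c u = ∑ v, u v * (1 ⊗ₜ[K] wordMonomial K v.toList) := by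
    simp [c, LinearMap.sum_apply]
  have key : tp K (gp K a) (gp K (n + r)) ≤
      (Submodule.pi Set.univ fun _ => tp K (gp K a) (gp K n)).map c := by
    rw [tp_gp_le_iff]
    intro v w hv hw
    obtain ⟨z₀, hz₀⟩ : ∃ z : List.Vector (Fin 2) r, z.toList = w.drop n :=
      ⟨⟨w.drop n, by simp [hw]⟩, rfl⟩
    refine ⟨Pi.single z₀ (wordMonomial K v ⊗ₜ[K] wordMonomial K (w.take n)), ?_, ?_⟩
    · intro z _
      rcases eq_or_ne z z₀ with rfl | hz
      · rw [Pi.single_eq_same]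
        refine tmul_mem_tp (hv ▸ wordMonomial_mem_gp K v) ?_
        have h := wordMonomial_mem_gp K (w.take n)
        rwa [List.length_take, hw, Nat.min_eq_left (Nat.le_add_right n r)] at h
      · rw [Pi.single_eq_of_ne hz]
        exact zero_mem _
    · rw [hc, Finset.sum_eq_single z₀]
      · rw [Pi.single_eq_same, Algebra.TensorProduct.tmul_mul_tmul, mul_one, hz₀,
          ← wordMonomial_append, List.take_append_drop]
      · intro z _ hz
        rw [Pi.single_eq_of_ne hz, zero_mul]
      · simp
  obtain ⟨u, hu, rfl⟩ := key hx
  exact ⟨u, fun v => hu v trivial, hc u⟩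

lemma exists_bihomogeneous_components {K : Type} [Field K] {I J : Finset ℕ} {f : FA K ⊗[K] FA K}
    (hf : f ∈ ⨆ i ∈ I, ⨆ j ∈ J, tp K (gp K i) (gp K j)) :
    ∃ F : ℕ × ℕ → FA K ⊗[K] FA K, (∀ e, F e ∈ tp K (gp K e.1) (gp K e.2)) ∧
      f = ∑ e ∈ I ×ˢ J, F e := by
  obtain ⟨g, rfl⟩ := (Submodule.mem_iSup_finset_iff_exists_sum _ f).1 hf
  have h (i : ℕ) := (Submodule.mem_iSup_finset_iff_exists_sum _ _).1 (g i).2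
  choose F hF using h
  refine ⟨fun e => F e.1 e.2, fun e => (F e.1 e.2).2, ?_⟩
  rw [Finset.sum_product]
  exact Finset.sum_congr rfl fun i _ => (hF i).symm

section Expansion

variable {K : Type} [Field K]

/-- The sum of the members of a finitely supported family. -/
def totalSum (K : Type) [Field K] :
    (ℕ × ℕ →₀ FA K ⊗[K] FA K) →+ FA K ⊗[K] FA K :=
  Finsupp.liftAddHom fun _ => AddMonoidHom.id _

/-- Multiplication of a family indexed by bidegrees by `∑ e ∈ I, F e`, where `F e` is placed
in bidegree `e`. -/
def shiftMul (I : Finset (ℕ × ℕ)) (F : ℕ × ℕ → FA K ⊗[K] FA K) :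
    (ℕ × ℕ →₀ FA K ⊗[K] FA K) →+ (ℕ × ℕ →₀ FA K ⊗[K] FA K) :=
  Finsupp.liftAddHom fun d =>
    ∑ e ∈ I, (Finsupp.singleAddHom (d + e)).comp (AddMonoidHom.mulRight (F e))

lemma totalSum_shiftMul (I : Finset (ℕ × ℕ)) (F : ℕ × ℕ → FA K ⊗[K] FA K)
    (S : ℕ × ℕ →₀ FA K ⊗[K] FA K) :
    totalSum K (shiftMul I F S) = totalSum K S * ∑ e ∈ I, F e := by
  have h : (totalSum K).comp (shiftMul I F) =
      (AddMonoidHom.mulRight (∑ e ∈ I, F e)).comp (totalSum K) := by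
    ext d x : 2
    simp [totalSum, shiftMul, Finset.mul_sum, -Finsupp.single_mul]
  exact DFunLike.congr_fun h S

/-- The bihomogeneous pieces of `h * f ^ k` obtained by expanding the product and discarding a
partial product once its right degree has reached `n`. -/
def partialExpansion (n : ℕ) (I : Finset (ℕ × ℕ)) (F : ℕ × ℕ → FA K ⊗[K] FA K)
    (S : ℕ × ℕ →₀ FA K ⊗[K] FA K) : ℕ → (ℕ × ℕ →₀ FA K ⊗[K] FA K)
  | 0 => S
  | k + 1 => shiftMul I F ((partialExpansion n I F S k).filter fun d => d.2 < n)

/-- The bidegrees that can occur after `k` steps of an expansion. -/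
def AdmissibleBidegree (t n k : ℕ) (d : ℕ × ℕ) : Prop :=
  k ≤ d.1 ∧ d.1 ≤ t + t * k ∧ k ≤ d.2 ∧ d.2 ≤ t + t * k ∧ d.2 < n + t

open Classical in
/-- `A(i) ⊗ A(j)` if `(i, j)` is admissible, and `0` otherwise. -/
def admissibleTp (K : Type) [Field K] (t n k : ℕ) (d : ℕ × ℕ) : Submodule K (FA K ⊗[K] FA K) :=
  if AdmissibleBidegree t n k d then tp K (gp K d.1) (gp K d.2) else ⊥

lemma mem_admissibleTp {t n k : ℕ} {d : ℕ × ℕ} {x : FA K ⊗[K] FA K} :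
    x ∈ admissibleTp K t n k d ↔
      x = 0 ∨ AdmissibleBidegree t n k d ∧ x ∈ tp K (gp K d.1) (gp K d.2) := by
  unfold admissibleTp
  split_ifs with h
  · simp only [h, true_and]
    exact ⟨Or.inr, fun hx => hx.elim (fun hx => hx ▸ zero_mem _) id⟩
  · simp [h]

lemma shiftMul_mem_admissibleTp {t n k : ℕ} {F : ℕ × ℕ → FA K ⊗[K] FA K}
    (hF : ∀ e, F e ∈ tp K (gp K e.1) (gp K e.2)) {S : ℕ × ℕ →₀ FA K ⊗[K] FA K}
    (hS : ∀ d, S d ∈ admissibleTp K t n k d) (hSn : ∀ d, S d ≠ 0 → d.2 < n) (d : ℕ × ℕ) :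
    shiftMul (Finset.Icc 1 t ×ˢ Finset.Icc 1 t) F S d ∈ admissibleTp K t n (k + 1) d := by
  classical
  rw [shiftMul, Finsupp.liftAddHom_apply, Finsupp.sum, Finsupp.finsetSum_apply]
  refine sum_mem fun c hc => ?_
  rw [AddMonoidHom.finsetSum_apply, Finsupp.finsetSum_apply]
  refine sum_mem fun e he => ?_
  rw [AddMonoidHom.comp_apply, Finsupp.singleAddHom_apply, Finsupp.single_apply]
  split_ifs with h
  · subst h
    have hc0 : S c ≠ 0 := Finsupp.mem_support_iff.1 hc
    have hcn := hSn c hc0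
    obtain h0 | ⟨⟨h1, h2, h3, h4, h5⟩, hm⟩ := mem_admissibleTp.1 (hS c)
    · exact absurd h0 hc0
    simp only [Finset.mem_product, Finset.mem_Icc] at he
    refine mem_admissibleTp.2 (Or.inr ⟨⟨?_, ?_, ?_, ?_, ?_⟩, mul_mem_tp_gp hm (hF e)⟩) <;>
      simp only [Prod.fst_add, Prod.snd_add, Nat.mul_succ] <;> omega
  · exact zero_mem _

lemma partialExpansion_mem_admissibleTp {t n : ℕ} {F : ℕ × ℕ → FA K ⊗[K] FA K}
    (hF : ∀ e, F e ∈ tp K (gp K e.1) (gp K e.2)) {S : ℕ × ℕ →₀ FA K ⊗[K] FA K}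
    (hS : ∀ d, S d ∈ admissibleTp K t n 0 d) (k : ℕ) (d : ℕ × ℕ) :
    partialExpansion n (Finset.Icc 1 t ×ˢ Finset.Icc 1 t) F S k d ∈ admissibleTp K t n k d := by
  induction k generalizing d with
  | zero => exact hS d
  | succ k ih =>
    refine shiftMul_mem_admissibleTp hF (fun c => ?_) (fun c hc => ?_) d
    · rw [Finsupp.filter_apply]
      split_ifs
      · exact ih c
      · exact zero_mem _
    · by_contra h
      exact hc (Finsupp.filter_apply_neg _ _ h)

/-- If all pieces of right degree at least `n` have their multiples by powers of `f` in `W`, then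
so does `h * f ^ m`. -/
lemma totalSum_mul_pow_mem {t n m : ℕ} (hm : n ≤ m) {F : ℕ × ℕ → FA K ⊗[K] FA K}
    (hF : ∀ e, F e ∈ tp K (gp K e.1) (gp K e.2)) {S : ℕ × ℕ →₀ FA K ⊗[K] FA K}
    (hS : ∀ d, S d ∈ admissibleTp K t n 0 d) {f : FA K ⊗[K] FA K}
    (hf : f = ∑ e ∈ Finset.Icc 1 t ×ˢ Finset.Icc 1 t, F e)
    {W : Submodule K (FA K ⊗[K] FA K)}
    (hW : ∀ k ≤ n, ∀ d : ℕ × ℕ, n ≤ d.2 →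
      partialExpansion n (Finset.Icc 1 t ×ˢ Finset.Icc 1 t) F S k d * f ^ (m - k) ∈ W) :
    totalSum K S * f ^ m ∈ W := by
  have split (k : ℕ) (hk : k ≤ n)
      (hlow : totalSum K ((partialExpansion n (Finset.Icc 1 t ×ˢ Finset.Icc 1 t) F S k).filter
        fun d => d.2 < n) * f ^ (m - k) ∈ W) :
      totalSum K (partialExpansion n (Finset.Icc 1 t ×ˢ Finset.Icc 1 t) F S k) *
        f ^ (m - k) ∈ W := by
    rw [← Finsupp.filter_add_filter_not
      (partialExpansion n (Finset.Icc 1 t ×ˢ Finset.Icc 1 t) F S k) (fun d => d.2 < n),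
      map_add, add_mul]
    refine add_mem hlow ?_
    rw [totalSum, Finsupp.liftAddHom_apply, Finsupp.sum, Finset.sum_mul]
    refine sum_mem fun d _ => ?_
    rw [AddMonoidHom.id_apply, Finsupp.filter_apply]
    split_ifs with h
    · rw [zero_mul]
      exact zero_mem _
    · exact hW k hk d (not_lt.1 h)
  have main (j : ℕ) : ∀ k, k + j = n →
      totalSum K (partialExpansion n (Finset.Icc 1 t ×ˢ Finset.Icc 1 t) F S k) *
        f ^ (m - k) ∈ W := by
    induction j with
    | zero =>
      rintro k rfl
      refine split k le_rfl ?_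
      have hz : ((partialExpansion k (Finset.Icc 1 t ×ˢ Finset.Icc 1 t) F S k).filter
          fun d => d.2 < k) = 0 := by
        ext1 d
        rw [Finsupp.filter_apply, Finsupp.zero_apply]
        split_ifs with h
        · obtain h0 | ⟨h1, -⟩ :=
            mem_admissibleTp.1 (partialExpansion_mem_admissibleTp hF hS k d)
          · exact h0
          · exact absurd h1.2.2.1 (not_le.2 h)
        · rfl
      rw [add_zero, hz, map_zero, zero_mul]
      exact zero_mem _
    | succ j ih =>
      intro k hk
      refine split k (by omega) ?_
      have h := ih (k + 1) (by omega)
      rw [partialExpansion, totalSum_shiftMul, ← hf, mul_assoc, ← pow_succ'] at h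
      rwa [show m - (k + 1) + 1 = m - k by omega] at h
  exact main n 0 (zero_add n)

end Expansion

lemma card_short_words_lt (N : ℕ) :
    Fintype.card (Σ r : Fin N, List.Vector (Fin 2) r) < 2 ^ N := by
  rw [Fintype.card_sigma]
  simp only [card_vector, Fintype.card_fin]
  rw [Fin.sum_univ_eq_sum_range (fun r => 2 ^ r) N]
  exact Nat.geomSum_lt le_rfl fun k hk => Finset.mem_range.1 hk

lemma index_count_lt {t n p q : ℕ} (ht : 1 ≤ t) (hn : 2 * t < n) (hp : p < 2 ^ (t + 1))
    (hq : q < 2 ^ t) :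
    p * p * ((n + 1) * ((t + t * n + 1) * q)) < 2 ^ (4 * t + 3) * n ^ 3 * t ^ 2 := by
  have h1 : n + 1 ≤ 2 * n := by omega
  have h2 : t + t * n + 1 ≤ 2 * (t * n) := by nlinarith
  have h3 : 2 ≤ 2 ^ t := by simpa using Nat.pow_le_pow_right (n := 2) (by norm_num) ht
  have htn : 0 < t * n := Nat.mul_pos ht (by omega)
  calc p * p * ((n + 1) * ((t + t * n + 1) * q))
      ≤ 2 ^ (t + 1) * 2 ^ (t + 1) * (2 * n * (2 * (t * n) * q)) := by gcongr
    _ < 2 ^ (t + 1) * 2 ^ (t + 1) * (2 * n * (2 * (t * n) * 2 ^ t)) := by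
        have : 0 < n := by omega
        gcongr
    _ = 2 ^ (3 * t + 3) * n ^ 2 * t * 2 := by ring
    _ ≤ 2 ^ (3 * t + 3) * n ^ 2 * t * (2 ^ t * (t * n)) := by
        gcongr
        nlinarith
    _ = 2 ^ (4 * t + 3) * n ^ 3 * t ^ 2 := by ring


theorem statement13 (K : Type) [Field K] (t : ℕ) (ht : 1 ≤ t)
    (f : FA K ⊗[K] FA K)
    (hf : f ∈ ⨆ i ∈ Finset.Icc 1 t, ⨆ j ∈ Finset.Icc 1 t, tp K (gp K i) (gp K j))
    (n : ℕ) (hn : 2 * t < n) :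
    ∃ T' : Submodule K (FA K ⊗[K] FA K),
      T' ≤ tp K (midGp' K t n) (gp K n) ∧
      IsHomog K T' ∧
      Module.finrank K T' < 2 ^ (4 * t + 3) * n ^ 3 * t ^ 2 ∧
      ∀ m : ℕ, n ≤ m →
        Hsp K t * Submodule.span K {f ^ m} ≤
          T' * Hsp K t * Submodule.span K {f ^ (m - n)} * ⊤ := by
  classical
  obtain ⟨F, hF, hfF⟩ := exists_bihomogeneous_components hf
  let Word (N : ℕ) := Σ r : Fin N, List.Vector (Fin 2) r
  let start (p : Word (t + 1) × Word (t + 1)) : ℕ × ℕ →₀ FA K ⊗[K] FA K :=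
    Finsupp.single (p.1.1, p.2.1)
      (wordMonomial K p.1.2.toList ⊗ₜ[K] wordMonomial K p.2.2.toList)
  have hstart (p) (d) : start p d ∈ admissibleTp K t n 0 d := by
    rw [Finsupp.single_apply]
    split_ifs with h
    · subst h
      have h1 := p.1.1.2
      have h2 := p.2.1.2
      refine mem_admissibleTp.2 (Or.inr ⟨⟨by simp, ?_, by simp, ?_, ?_⟩, tmul_mem_tp ?_ ?_⟩)
      · simp only; omega
      · simp only; omega
      · simp only; omega
      · simpa using wordMonomial_mem_gp K p.1.2.toList
      · simpa using wordMonomial_mem_gp K p.2.2.toList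
    · exact zero_mem _
  have hcoeff (p) (k a r : ℕ) : ∃ u : List.Vector (Fin 2) r → FA K ⊗[K] FA K,
      (∀ v, u v = 0 ∨
        AdmissibleBidegree t n k (a, n + r) ∧ u v ∈ tp K (gp K a) (gp K n)) ∧
      partialExpansion n (Finset.Icc 1 t ×ˢ Finset.Icc 1 t) F (start p) k (a, n + r) =
        ∑ v, u v * (1 ⊗ₜ[K] wordMonomial K v.toList) := by
    obtain h0 | ⟨had, hm⟩ := mem_admissibleTp.1
      (partialExpansion_mem_admissibleTp hF (hstart p) k (a, n + r))
    · exact ⟨0, fun _ => Or.inl rfl, by simp [h0]⟩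
    · obtain ⟨u, hu, hsum⟩ := exists_right_coefficients hm
      exact ⟨u, fun v => Or.inr ⟨had, hu v⟩, hsum⟩
  choose u hu husum using hcoeff
  let gen (x : (Word (t + 1) × Word (t + 1)) × Fin (n + 1) × Fin (t + t * n + 1) × Word t) :
      FA K ⊗[K] FA K := u x.1 x.2.1 x.2.2.1 x.2.2.2.1 x.2.2.2.2
  have hgen (x) : gen x = 0 ∨ AdmissibleBidegree t n x.2.1 (x.2.2.1, n + x.2.2.2.1) ∧
      gen x ∈ tp K (gp K x.2.2.1) (gp K n) := hu _ _ _ _ _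
  refine ⟨Submodule.span K (Set.range gen), ?_, ⟨Set.range gen, ?_, rfl⟩, ?_, ?_⟩
  · rw [Submodule.span_le]
    rintro _ ⟨x, rfl⟩
    obtain h0 | ⟨⟨h1, h2, -, h4, -⟩, hm⟩ := hgen x
    · rw [h0]
      exact zero_mem _
    · refine Submodule.map₂_le_map₂_left ?_ hm
      refine le_iSup₂_of_le (x.2.2.1 : ℕ) ⟨?_, ?_⟩ le_rfl
      · simp only at h1 h4
        nlinarith [Nat.mul_le_mul_left t h1]
      · have := x.2.2.1.2
        nlinarith
  · rintro _ ⟨x, rfl⟩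
    obtain h0 | ⟨-, hm⟩ := hgen x
    · exact ⟨0, 0, h0 ▸ zero_mem _⟩
    · exact ⟨_, _, hm⟩
  · refine (finrank_range_le_card gen).trans_lt ?_
    simp only [Fintype.card_prod, Fintype.card_fin]
    exact index_count_lt ht hn (card_short_words_lt (t + 1)) (card_short_words_lt t)
  · intro m hm
    set W := Submodule.span K (Set.range gen) * Hsp K t * Submodule.span K {f ^ (m - n)} * ⊤
    have hpiece (p) : ∀ k ≤ n, ∀ d : ℕ × ℕ, n ≤ d.2 →
        partialExpansion n (Finset.Icc 1 t ×ˢ Finset.Icc 1 t) F (start p) k d *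
          f ^ (m - k) ∈ W := by
      rintro k hk ⟨a, b⟩ hb
      obtain ⟨r, rfl⟩ := Nat.exists_eq_add_of_le hb
      obtain h0 | ⟨⟨-, h2, -, -, h5⟩, -⟩ := mem_admissibleTp.1
        (partialExpansion_mem_admissibleTp hF (hstart p) k (a, n + r))
      · rw [h0, zero_mul]
        exact zero_mem _
      simp only at h2 h5
      have ha : a < t + t * n + 1 := by nlinarith [Nat.mul_le_mul_left t hk]
      have hr : r < t := by omega
      rw [husum, Finset.sum_mul]
      refine sum_mem fun v _ => ?_
      rw [show m - k = m - n + (n - k) by omega, pow_add, ← mul_assoc]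
      refine Submodule.mul_mem_mul (Submodule.mul_mem_mul (Submodule.mul_mem_mul ?_ ?_)
        (Submodule.mem_span_singleton_self _)) Submodule.mem_top
      · exact Submodule.subset_span
          ⟨(p, ⟨k, by omega⟩, ⟨a, ha⟩, ⟨⟨r, hr⟩, v⟩), rfl⟩
      · refine Submodule.mem_iSup_of_mem 0 (Submodule.mem_iSup_of_mem (by simp)
          (Submodule.mem_iSup_of_mem r (Submodule.mem_iSup_of_mem (by simp [hr.le])
            (tmul_mem_tp ?_ ?_))))
        · exact wordMonomial_mem_gp K []
        · simpa using wordMonomial_mem_gp K v.toList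
    have hH : Hsp K t ≤ W.comap (LinearMap.mulRight K (f ^ m)) := by
      refine iSup₂_le fun i hi => iSup₂_le fun j hj => tp_gp_le_iff.2 fun v w hv hw => ?_
      rw [Finset.mem_Iic] at hi hj
      have h := totalSum_mul_pow_mem hm hF
        (hstart (⟨⟨i, by omega⟩, v, hv⟩, ⟨⟨j, by omega⟩, w, hw⟩)) hfF (hpiece _)
      simpa [totalSum, start] using h
    rw [Submodule.mul_le]
    intro h hh y hy
    obtain ⟨c, rfl⟩ := Submodule.mem_span_singleton.1 hy
    rw [mul_smul_comm]
    exact W.smul_mem c (hH hh)
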